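/- Boundary-length bound from the proof of Lemma 3.9: Let (V, E, F) be a combinatorial triangulated disk datum such that |V| − |E| + |F| = 1 and the number of boundary vertices equals the number of boundary edges. If deg(v) ≥ 6 for every interior vertex v and deg(v) ≥ 3 for every boundary vertex v, then there are at least 6 boundary vertices. -/

import Mathlib

open scoped Classical

/-- A combinatorial triangulated disk datum: finite sets of vertices, edges
(2-element subsets) and faces (3-element subsets), such that every 2-element
subset of a face is an edge, and every edge lies in exactly one or two faces. -/
structure DiskDatum (α : Type*) [DecidableEq α] where
  V : Finset α
  E : Finset (Finset α)
  F : Finset (Finset α)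
  edge_card : ∀ e ∈ E, e.card = 2
  edge_sub : ∀ e ∈ E, e ⊆ V
  face_card : ∀ f ∈ F, f.card = 3
  face_sub : ∀ f ∈ F, f ⊆ V
  face_edges : ∀ f ∈ F, ∀ e ⊆ f, e.card = 2 → e ∈ E
  edge_faces : ∀ e ∈ E, (F.filter (fun f => e ⊆ f)).card = 1 ∨
      (F.filter (fun f => e ⊆ f)).card = 2

variable {α : Type*} [DecidableEq α]

/-- A boundary edge is an edge contained in exactly one face. -/
def DiskDatum.IsBoundaryEdge (D : DiskDatum α) (e : Finset α) : Prop :=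
  e ∈ D.E ∧ (D.F.filter (fun f => e ⊆ f)).card = 1

/-- A boundary vertex is a vertex lying on some boundary edge. -/
def DiskDatum.IsBoundaryVertex (D : DiskDatum α) (v : α) : Prop :=
  ∃ e, D.IsBoundaryEdge e ∧ v ∈ e

/-- The degree of a vertex is the number of edges containing it. -/
def DiskDatum.deg (D : DiskDatum α) (v : α) : ℕ :=
  (D.E.filter (fun e => v ∈ e)).card

/-- The handshake identity: the degrees sum to twice the number of edges. -/
theorem DiskDatum.sum_deg (D : DiskDatum α) : ∑ v ∈ D.V, D.deg v = 2 * D.E.card := by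
  have h := Finset.sum_card_bipartiteAbove_eq_sum_card_bipartiteBelow
    (s := D.V) (t := D.E) (fun v e => v ∈ e)
  have hE : ∀ e ∈ D.E, (D.V.bipartiteBelow (fun v e => v ∈ e) e).card = 2 := by
    intro e he
    rw [← D.edge_card e he]
    congr 1
    ext v
    simpa [Finset.mem_bipartiteBelow] using fun hv => D.edge_sub e he hv
  rw [Finset.sum_congr rfl hE, Finset.sum_const, smul_eq_mul, mul_comm] at h
  rw [← h]
  refine Finset.sum_congr rfl fun v _ => ?_
  unfold DiskDatum.deg Finset.bipartiteAbove
  congr!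

/-- Counting edge-face incidences: every face has three edges, and every edge lies in two faces
except that boundary edges lie in one. -/
theorem DiskDatum.three_mul_card_faces_add (D : DiskDatum α) :
    3 * D.F.card + (D.E.filter (fun e => D.IsBoundaryEdge e)).card = 2 * D.E.card := by
  have h := Finset.sum_card_bipartiteAbove_eq_sum_card_bipartiteBelow
    (s := D.E) (t := D.F) (fun e f => e ⊆ f)
  have hF : ∀ f ∈ D.F, (D.E.bipartiteBelow (fun e f => e ⊆ f) f).card = 3 := by
    intro f hf
    have : D.E.bipartiteBelow (fun e f => e ⊆ f) f = f.powersetCard 2 := by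
      ext e
      rw [Finset.mem_bipartiteBelow, Finset.mem_powersetCard]
      exact ⟨fun ⟨he, hef⟩ => ⟨hef, D.edge_card e he⟩,
        fun ⟨hef, he⟩ => ⟨D.face_edges f hf e hef he, hef⟩⟩
    rw [this, Finset.card_powersetCard, D.face_card f hf]
    rfl
  rw [Finset.sum_congr rfl hF, Finset.sum_const, smul_eq_mul, mul_comm] at h
  rw [← h, Finset.card_filter, ← Finset.sum_add_distrib, mul_comm, ← smul_eq_mul,
    ← Finset.sum_const]
  refine Finset.sum_congr rfl fun e he => ?_
  have hdeg : (D.F.bipartiteAbove (fun e f => e ⊆ f) e).card =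
      (D.F.filter (fun f => e ⊆ f)).card := by
    unfold Finset.bipartiteAbove
    congr!
  rw [hdeg]
  rcases D.edge_faces e he with h1 | h2
  · rw [if_pos ⟨he, h1⟩, h1]
  · rw [if_neg fun hb => by have := hb.2; omega, h2]

/-- Boundary-length bound from the proof of Lemma 3.9: if every interior vertex
has degree at least six and every boundary vertex has degree at least three,
then there are at least six boundary vertices. -/
theorem six_boundary_vertices (D : DiskDatum α)
    (euler : (D.V.card : ℤ) - (D.E.card : ℤ) + (D.F.card : ℤ) = 1)
    (hbd : (D.V.filter (fun v => D.IsBoundaryVertex v)).card =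
      (D.E.filter (fun e => D.IsBoundaryEdge e)).card)
    (hint : ∀ v ∈ D.V, ¬ D.IsBoundaryVertex v → 6 ≤ D.deg v)
    (hbdry : ∀ v ∈ D.V, D.IsBoundaryVertex v → 3 ≤ D.deg v) :
    6 ≤ (D.V.filter (fun v => D.IsBoundaryVertex v)).card := by
  have hdeg := D.sum_deg
  have hfaces := D.three_mul_card_faces_add
  have hlow : D.V.card * 6 ≤
      ∑ v ∈ D.V, D.deg v + 3 * (D.V.filter (fun v => D.IsBoundaryVertex v)).card := by
    rw [Finset.card_filter, Finset.mul_sum, ← Finset.sum_add_distrib, ← smul_eq_mul,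
      ← Finset.sum_const]
    refine Finset.sum_le_sum fun v hv => ?_
    by_cases hb : D.IsBoundaryVertex v
    · have := hbdry v hv hb
      rw [if_pos hb]
      omega
    · have := hint v hv hb
      rw [if_neg hb]
      omega
  omega
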